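/- Let (W, S) be a Coxeter system with length function ℓ, and let δ be an automorphism of W with δ(S) = S. Let J ⊆ S with δ(J) = J, and let w ∈ W be of minimal length in its coset W_J·w. Write supp(w) ⊆ S for the set of simple reflections occurring in some (equivalently, any) reduced word for w, and supp_δ(w) := ∪_{m ∈ ℤ} δ^m(supp(w)). Assume that the standard parabolic subgroup W_{supp_δ(w)} is finite and that w is a δ-Coxeter element of W_{supp_δ(w)}, i.e. ℓ(w) equals the number of orbits of δ on supp_δ(w). Then the largest subset K ⊆ J satisfying w·δ(K)·w^{-1} = K (largest with respect to inclusion; such a largest subset exists since the property is preserved under unions) equals {s ∈ J : s commutes with every element of supp_δ(w)}. Consequently, every simple reflection in this largest subset commutes with every simple reflection in supp_δ(w). -/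

import Mathlib

open Classical
noncomputable section

/-- the support of w : the set of simple reflections occurring in some (equivalently, any)
    reduced word for w -/
def csSupp {B W : Type*} [Group W] {M : CoxeterMatrix B} (cs : CoxeterSystem M W)
    (w : W) : Set W :=
  {s | ∃ l : List B, cs.IsReduced l ∧ cs.wordProd l = w ∧ s ∈ l.map cs.simple}

/-- supp_δ(w) = ∪_{m ∈ ℤ} δ^m(supp w) -/
def csSuppDelta {B W : Type*} [Group W] {M : CoxeterMatrix B} (cs : CoxeterSystem M W)
    (δ : MulAut W) (w : W) : Set W :=
  ⋃ m : ℤ, (δ ^ m) '' csSupp cs w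

/-- the number of orbits of the automorphism δ on the set A -/
def orbCount {W : Type*} [Group W] (δ : MulAut W) (A : Set W) : ℕ :=
  {O : Set W | ∃ s ∈ A, O = {t | ∃ m : ℤ, (δ ^ m) s = t}}.ncard

namespace CoxeterSystem

variable {B W : Type*} [Group W] {M : CoxeterMatrix B} (cs : CoxeterSystem M W)

/-- The signed conjugation action of a simple reflection on pairs `(t, ε)`. -/
def signedConj (i : B) : Function.End (W × ZMod 2) :=
  fun p => (cs.simple i * p.1 * cs.simple i, p.2 + if p.1 = cs.simple i then 1 else 0)

theorem signedConj_mul_pow (i i' : B) (m : ℕ) (t : W) (ε : ZMod 2) :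
    ((cs.signedConj i * cs.signedConj i') ^ m : Function.End (W × ZMod 2)) (t, ε) =
      ((cs.simple i * cs.simple i') ^ m * t * ((cs.simple i * cs.simple i') ^ m)⁻¹,
        ε + ∑ k ∈ Finset.range (2 * m),
          if t = cs.simple i' * (cs.simple i * cs.simple i') ^ k then 1 else 0) := by
  set r := cs.simple i * cs.simple i' with hr
  have hrinv : r⁻¹ = cs.simple i' * cs.simple i := by simp [hr]
  have hconj : ∀ k : ℕ, (r ^ k)⁻¹ * cs.simple i' = cs.simple i' * r ^ k := by
    intro k
    induction k with
    | zero => simp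
    | succ k ih =>
      calc (r ^ (k + 1))⁻¹ * cs.simple i' = r⁻¹ * ((r ^ k)⁻¹ * cs.simple i') := by
            rw [pow_succ, mul_inv_rev, mul_assoc]
        _ = cs.simple i' * r ^ (k + 1) := by
            rw [ih, hrinv, pow_succ' r k, hr]; simp [mul_assoc]
  induction m with
  | zero => simp; rfl
  | succ m ih =>
    have hstep : ((cs.signedConj i * cs.signedConj i') ^ (m + 1) : Function.End (W × ZMod 2)) (t, ε)
        = cs.signedConj i (cs.signedConj i'
          (((cs.signedConj i * cs.signedConj i') ^ m : Function.End (W × ZMod 2)) (t, ε))) := by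
      rw [pow_succ']; rfl
    have hone : r ^ m * t * (r ^ m)⁻¹ = cs.simple i' ↔ t = cs.simple i' * r ^ (2 * m) := by
      rw [mul_inv_eq_iff_eq_mul, ← eq_inv_mul_iff_mul_eq, ← mul_assoc, hconj, mul_assoc,
        ← pow_add, two_mul]
    have htwo : cs.simple i' * (r ^ m * t * (r ^ m)⁻¹) * cs.simple i' = cs.simple i ↔
        t = cs.simple i' * r ^ (2 * m + 1) := by
      have hrefl : cs.simple i' * (r ^ m * t * (r ^ m)⁻¹) * cs.simple i' = cs.simple i ↔
          r ^ m * t * (r ^ m)⁻¹ = cs.simple i' * r := by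
        generalize r ^ m * t * (r ^ m)⁻¹ = x
        constructor
        · intro h
          rw [hr, ← h]; simp only [mul_assoc, cs.simple_mul_simple_cancel_left,
            cs.simple_mul_simple_self, mul_one]
        · intro h
          rw [h, hr]; simp [mul_assoc]
      rw [hrefl, mul_inv_eq_iff_eq_mul, ← eq_inv_mul_iff_mul_eq, ← mul_assoc, ← mul_assoc, hconj,
        mul_assoc, mul_assoc, ← pow_succ', ← pow_add]
      congr! 3
      omega
    rw [hstep, ih]
    simp only [signedConj]
    rw [Prod.mk.injEq]
    constructor
    · rw [pow_succ' r m, mul_inv_rev, hrinv, hr]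
      simp only [mul_assoc]
    · rw [show 2 * (m + 1) = 2 * m + 1 + 1 by ring, Finset.sum_range_succ, Finset.sum_range_succ]
      simp only [hone, htwo, add_assoc]

theorem signedConj_isLiftable : M.IsLiftable cs.signedConj := by
  intro i i'
  funext ⟨t, ε⟩
  rw [signedConj_mul_pow, cs.simple_mul_simple_pow]
  have hsum : ∑ k ∈ Finset.range (2 * M i i'),
      (if t = cs.simple i' * (cs.simple i * cs.simple i') ^ k then 1 else 0 : ZMod 2) = 0 := by
    rw [two_mul, Finset.sum_range_add]
    simp only [pow_add, cs.simple_mul_simple_pow, one_mul]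
    exact CharTwo.add_self_eq_zero _
  rw [hsum]
  simp; rfl

/-- The action of `W` on signed elements extending `signedConj`. -/
def signedAction : W →* Function.End (W × ZMod 2) :=
  cs.lift ⟨cs.signedConj, cs.signedConj_isLiftable⟩

theorem signedAction_simple (i : B) : cs.signedAction (cs.simple i) = cs.signedConj i :=
  cs.lift_apply_simple _ i

theorem signedAction_wordProd (ω : List B) (t : W) (ε : ZMod 2) :
    cs.signedAction (cs.wordProd ω) (t, ε) =
      (cs.wordProd ω * t * (cs.wordProd ω)⁻¹, ε + ((cs.rightInvSeq ω).count t : ZMod 2)) := by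
  induction ω with
  | nil => simp; rfl
  | cons i ω ih =>
    have hstep : cs.signedAction (cs.wordProd (i :: ω)) (t, ε) =
        cs.signedConj i (cs.signedAction (cs.wordProd ω) (t, ε)) := by
      rw [wordProd_cons, map_mul, signedAction_simple]; rfl
    have hiff : cs.wordProd ω * t * (cs.wordProd ω)⁻¹ = cs.simple i ↔
        (cs.wordProd ω)⁻¹ * cs.simple i * cs.wordProd ω = t := by
      constructor <;> intro h
      · rw [← h]; group
      · rw [← h]; group
    rw [hstep, ih]
    simp only [signedConj, rightInvSeq, List.count_cons, hiff, beq_iff_eq]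
    rw [Prod.mk.injEq]
    constructor
    · simp [wordProd_cons, mul_assoc]
    · push_cast
      rw [add_assoc]

theorem exists_eraseIdx_of_isRightDescent (ω : List B) (i : B)
    (h : cs.IsRightDescent (cs.wordProd ω) i) :
    ∃ j < ω.length, cs.wordProd ω * cs.simple i = cs.wordProd (ω.eraseIdx j) := by
  obtain ⟨ω', hω', hprod⟩ := cs.exists_isReduced (cs.wordProd ω * cs.simple i)
  have hnot : cs.simple i ∉ cs.rightInvSeq ω' := by
    intro hmem
    have := (cs.isRightInversion_of_mem_rightInvSeq hω' hmem).2
    rw [← hprod, cs.simple_mul_simple_cancel_right] at this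
    exact lt_asymm this h
  have hact : cs.signedAction (cs.wordProd ω) (cs.simple i, 0) =
      cs.signedAction (cs.wordProd ω') (cs.simple i, 1) := by
    rw [← hprod, map_mul, signedAction_simple]
    change _ = cs.signedAction (cs.wordProd ω) (cs.signedConj i (cs.simple i, 1))
    simp only [signedConj, simple_mul_simple_self, one_mul, if_true]
    rw [CharTwo.add_self_eq_zero]
  have hcount : ((cs.rightInvSeq ω).count (cs.simple i) : ZMod 2) = 1 := by
    have := congrArg Prod.snd hact
    rw [signedAction_wordProd, signedAction_wordProd, List.count_eq_zero_of_not_mem hnot] at this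
    simpa using this
  have hmem : cs.simple i ∈ cs.rightInvSeq ω := by
    by_contra hc
    rw [List.count_eq_zero_of_not_mem hc] at hcount
    simp at hcount
  obtain ⟨j, hj, hj'⟩ := List.mem_iff_getElem.mp hmem
  refine ⟨j, by simpa using hj, ?_⟩
  rw [← cs.wordProd_mul_getD_rightInvSeq, List.getD_eq_getElem _ _ hj, hj']

theorem wordProd_mem_closure {I : Set W} {ω : List B} (h : ∀ i ∈ ω, cs.simple i ∈ I) :
    cs.wordProd ω ∈ Subgroup.closure I := by
  refine Subgroup.list_prod_mem _ fun x hx => ?_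
  obtain ⟨i, hi, rfl⟩ := List.mem_map.mp hx
  exact Subgroup.subset_closure (h i hi)

theorem exists_isReduced_of_mem_closure {I : Set W} (hI : I ⊆ Set.range cs.simple) {w : W}
    (hw : w ∈ Subgroup.closure I) :
    ∃ ω, cs.IsReduced ω ∧ w = cs.wordProd ω ∧ ∀ i ∈ ω, cs.simple i ∈ I := by
  have hmul : ∀ x : W, ∀ y ∈ I,
      (∃ ω, cs.IsReduced ω ∧ x = cs.wordProd ω ∧ ∀ i ∈ ω, cs.simple i ∈ I) →
      ∃ ω, cs.IsReduced ω ∧ x * y = cs.wordProd ω ∧ ∀ i ∈ ω, cs.simple i ∈ I := by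
    rintro x y hy ⟨ω, hω, rfl, hωI⟩
    obtain ⟨i, rfl⟩ := hI hy
    rcases cs.length_mul_simple (cs.wordProd ω) i with hlen | hlen
    · refine ⟨ω ++ [i], ?_, by simp [wordProd_append], ?_⟩
      · rw [IsReduced, wordProd_append, wordProd_singleton, hlen, hω.eq]; simp
      · intro k hk
        rcases List.mem_append.mp hk with hk | hk
        · exact hωI k hk
        · rwa [List.mem_singleton.mp hk]
    · obtain ⟨j, hj, hprod⟩ := cs.exists_eraseIdx_of_isRightDescent ω i
        (show cs.length _ < cs.length _ by omega)
      refine ⟨ω.eraseIdx j, ?_, hprod, fun k hk => hωI k (List.mem_of_mem_eraseIdx hk)⟩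
      have := List.length_eraseIdx_add_one hj
      rw [IsReduced, ← hprod]
      rw [hω.eq] at hlen
      omega
  induction hw using Subgroup.closure_induction_right with
  | one => exact ⟨[], by simp [IsReduced], by simp, by simp⟩
  | mul_right x hx y hy ih => exact hmul x y hy ih
  | mul_inv_cancel x hx y hy ih =>
    have hinv : y⁻¹ = y := by
      obtain ⟨i, rfl⟩ := hI hy
      simp
    rw [hinv]
    exact hmul x y hy ih

theorem simple_mem_of_mem_closure {I : Set W} (hI : I ⊆ Set.range cs.simple) {i : B}
    (h : cs.simple i ∈ Subgroup.closure I) : cs.simple i ∈ I := by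
  obtain ⟨ω, hω, hprod, hmem⟩ := cs.exists_isReduced_of_mem_closure hI h
  have hlen : ω.length = 1 := by rw [← hω.eq, ← hprod, length_simple]
  obtain ⟨k, rfl⟩ := List.length_eq_one_iff.mp hlen
  rw [hprod, wordProd_singleton]
  exact hmem k (by simp)

theorem IsReduced.simple_mem_of_wordProd_mem_closure {cs : CoxeterSystem M W} {I : Set W}
    (hI : I ⊆ Set.range cs.simple) {ω : List B} (hω : cs.IsReduced ω)
    (h : cs.wordProd ω ∈ Subgroup.closure I) : ∀ i ∈ ω, cs.simple i ∈ I := by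
  induction ω using List.reverseRecOn with
  | nil => simp
  | append_singleton ω i ih =>
    have hω' : cs.IsReduced ω := by simpa using hω.take ω.length
    have hdesc : cs.wordProd (ω ++ [i]) * cs.simple i = cs.wordProd ω := by
      simp [wordProd_append]
    obtain ⟨χ, hχ, hprod, hmem⟩ := cs.exists_isReduced_of_mem_closure hI h
    have hrd : cs.IsRightDescent (cs.wordProd χ) i := by
      rw [IsRightDescent, ← hprod, hdesc, hω.eq, hω'.eq]; simp
    obtain ⟨j, hj, herase⟩ := cs.exists_eraseIdx_of_isRightDescent χ i hrd
    have hωI : cs.wordProd ω ∈ Subgroup.closure I := by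
      rw [← hdesc, hprod, herase]
      exact cs.wordProd_mem_closure fun k hk => hmem k (List.mem_of_mem_eraseIdx hk)
    intro k hk
    rcases List.mem_append.mp hk with hk | hk
    · exact ih hω' hωI k hk
    · rw [List.mem_singleton.mp hk]
      refine cs.simple_mem_of_mem_closure hI ?_
      have := Subgroup.mul_mem _ (Subgroup.inv_mem _ hωI) h
      rwa [wordProd_append, inv_mul_cancel_left, wordProd_singleton] at this

theorem mem_closure_inter {I I' : Set W} (hI : I ⊆ Set.range cs.simple)
    (hI' : I' ⊆ Set.range cs.simple) {x : W} (hx : x ∈ Subgroup.closure I)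
    (hx' : x ∈ Subgroup.closure I') : x ∈ Subgroup.closure (I ∩ I') := by
  obtain ⟨ω, hω, rfl⟩ := cs.exists_isReduced x
  exact cs.wordProd_mem_closure fun i hi =>
    ⟨hω.simple_mem_of_wordProd_mem_closure hI hx i hi,
      hω.simple_mem_of_wordProd_mem_closure hI' hx' i hi⟩

theorem conj_eq_self_of_mem_closure {I I' : Set W} (hI : I ⊆ Set.range cs.simple)
    (hI' : I' ⊆ Set.range cs.simple) {s g : W} (hs : s ∈ Set.range cs.simple)
    (hII' : I ∩ I' ⊆ {s}) (hx : g * s * g⁻¹ ∈ Subgroup.closure I)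
    (hx' : g * s * g⁻¹ ∈ Subgroup.closure I') : g * s * g⁻¹ = s := by
  obtain ⟨i, rfl⟩ := hs
  obtain ⟨n, hn⟩ := Subgroup.mem_closure_singleton.mp
    (Subgroup.closure_mono hII' (cs.mem_closure_inter hI hI' hx hx'))
  have hone : cs.simple i ≠ 1 := by
    rw [Ne, ← cs.length_eq_zero_iff, length_simple]; simp
  rcases Int.even_or_odd n with ⟨k, rfl⟩ | ⟨k, rfl⟩
  · rw [← two_mul, zpow_mul, zpow_ofNat, simple_sq, one_zpow] at hn
    exact absurd (by simpa using hn.symm) hone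
  · rw [zpow_add, zpow_mul, zpow_ofNat, simple_sq, one_zpow, one_mul, zpow_one] at hn
    exact hn.symm

theorem length_prod_le {L : List W} (hL : ∀ x ∈ L, x ∈ Set.range cs.simple) :
    cs.length L.prod ≤ L.length := by
  induction L with
  | nil => simp
  | cons a L ih =>
    obtain ⟨i, rfl⟩ := hL a (by simp)
    have hmul := cs.length_mul_le (cs.simple i) L.prod
    have := ih fun x hx => hL x (List.mem_cons_of_mem _ hx)
    rw [length_simple] at hmul
    rw [List.prod_cons, List.length_cons]
    omega

theorem _root_.List.prod_mem_closure {G : Type*} [Group G] {L : List G} {I : Set G}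
    (h : ∀ x ∈ L, x ∈ I) : L.prod ∈ Subgroup.closure I :=
  Subgroup.list_prod_mem _ fun x hx => Subgroup.subset_closure (h x hx)

theorem commute_of_commute_prod {L : List W} (hL : ∀ x ∈ L, x ∈ Set.range cs.simple)
    (hnd : L.Nodup) {s : W} (hs : s ∈ Set.range cs.simple) (hsL : s ∉ L)
    (hcomm : L.prod * s = s * L.prod) : ∀ x ∈ L, s * x = x * s := by
  induction L with
  | nil => simp
  | cons a L ih =>
    rw [List.nodup_cons] at hnd
    rw [List.mem_cons, not_or] at hsL
    have haS := hL a (by simp)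
    have hLS := fun x hx => hL x (List.mem_cons_of_mem a hx)
    have hainv : a⁻¹ = a := by obtain ⟨i, rfl⟩ := haS; simp
    rw [List.prod_cons] at hcomm
    have hconj : a * s * a⁻¹ = L.prod * s * L.prod⁻¹ := by
      rw [eq_mul_inv_iff_mul_eq, hainv]
      calc a * s * a * L.prod = a * (s * (a * L.prod)) := by simp only [mul_assoc]
        _ = a⁻¹ * (a * L.prod * s) := by rw [hcomm, hainv]
        _ = L.prod * s := by group
    have hmem : a * s * a⁻¹ ∈ Subgroup.closure ({a, s} : Set W) := by
      have ha : a ∈ Subgroup.closure ({a, s} : Set W) := Subgroup.subset_closure (by simp)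
      have hs : s ∈ Subgroup.closure ({a, s} : Set W) := Subgroup.subset_closure (by simp)
      exact mul_mem (mul_mem ha hs) (inv_mem ha)
    have hmem' : a * s * a⁻¹ ∈ Subgroup.closure ({x | x ∈ L} ∪ {s} : Set W) := by
      rw [hconj]
      have hv : L.prod ∈ Subgroup.closure ({x | x ∈ L} ∪ {s} : Set W) :=
        List.prod_mem_closure fun x hx => Or.inl hx
      exact mul_mem (mul_mem hv (Subgroup.subset_closure (Or.inr rfl))) (inv_mem hv)
    have heq : a * s * a⁻¹ = s := by
      refine cs.conj_eq_self_of_mem_closure ?_ ?_ hs ?_ hmem hmem'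
      · rintro x (rfl | rfl)
        exacts [haS, hs]
      · rintro x (hx | rfl)
        exacts [hLS x hx, hs]
      · rintro x ⟨rfl | rfl, hx⟩
        · rcases hx with hx | hx
          · exact absurd hx hnd.1
          · exact hx
        · rfl
    intro x hx
    rcases List.mem_cons.mp hx with rfl | hx
    · exact (mul_inv_eq_iff_eq_mul.mp heq).symm
    · refine ih hLS hnd.2 hsL.2 ?_ x hx
      rw [heq] at hconj
      exact (mul_inv_eq_iff_eq_mul.mp hconj.symm)

theorem mul_prod_eq_of_mem_left {U V : List W} {s s' : W}
    (hL : ∀ x ∈ U ++ s' :: V, x ∈ Set.range cs.simple) (hnd : (U ++ s' :: V).Nodup)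
    (hconj : (U ++ s' :: V).prod * s' = s * (U ++ s' :: V).prod) (hs : s ∈ U ++ [s']) :
    s * (U ++ s' :: V).prod = (U ++ V).prod := by
  have hs'S := hL s' (by simp)
  have hinv : s' * s' = 1 := by obtain ⟨i, rfl⟩ := hs'S; simp
  have hU : ∀ x ∈ U ++ [s'], x ∈ Set.range cs.simple := fun x hx => hL x (by grind)
  have hV : ∀ x ∈ s' :: V, x ∈ Set.range cs.simple := fun x hx => hL x (by grind)
  have hsplit : (U ++ s' :: V).prod = (U ++ [s']).prod * V.prod := by simp [mul_assoc]
  have hmem : V.prod * s' * V.prod⁻¹ ∈ Subgroup.closure {x | x ∈ U ++ [s']} := by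
    have heq : V.prod * s' * V.prod⁻¹ = (U ++ [s']).prod⁻¹ * s * (U ++ [s']).prod := by
      rw [hsplit] at hconj
      rw [mul_inv_eq_iff_eq_mul, mul_assoc, mul_assoc, ← hconj]
      group
    rw [heq]
    have hu : (U ++ [s']).prod ∈ Subgroup.closure {x | x ∈ U ++ [s']} :=
      List.prod_mem_closure fun x hx => hx
    exact mul_mem (mul_mem (inv_mem hu) (Subgroup.subset_closure hs)) hu
  have hmem' : V.prod * s' * V.prod⁻¹ ∈ Subgroup.closure {x | x ∈ s' :: V} := by
    have hv : V.prod ∈ Subgroup.closure {x | x ∈ s' :: V} :=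
      List.prod_mem_closure fun x hx => List.mem_cons_of_mem _ hx
    exact mul_mem (mul_mem hv (Subgroup.subset_closure (by simp))) (inv_mem hv)
  have heq := cs.conj_eq_self_of_mem_closure hU hV hs'S (by
    rintro x ⟨hx, hx'⟩
    have hxU : x ∈ U ++ [s'] := hx
    have hxV : x ∈ s' :: V := hx'
    rw [Set.mem_singleton_iff]
    clear hx hx' hmem hmem' hU hV hL hconj
    grind) hmem hmem'
  rw [mul_inv_eq_iff_eq_mul] at heq
  rw [← hconj, hsplit, mul_assoc, heq]
  simp only [List.prod_append, List.prod_singleton]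
  rw [mul_assoc, ← mul_assoc s' s', hinv, one_mul]

/-- If `w` is a product of distinct simple reflections and conjugates the simple reflection `s'`
to the simple reflection `s`, where `s` is not a left descent of `w`, then either `s = s'` commutes
with all the factors and is not one of them, or `s'` is a factor occurring strictly before `s`. -/
theorem eq_and_commute_or_precedes {L : List W} (hL : ∀ x ∈ L, x ∈ Set.range cs.simple)
    (hnd : L.Nodup) (hlen : cs.length L.prod = L.length) {s s' : W}
    (hs : s ∈ Set.range cs.simple) (hs' : s' ∈ Set.range cs.simple)
    (hconj : L.prod * s' = s * L.prod) (hdesc : cs.length L.prod ≤ cs.length (s * L.prod)) :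
    (s = s' ∧ s ∉ L ∧ ∀ x ∈ L, s * x = x * s) ∨ ∃ U V, L = U ++ s' :: V ∧ s ∈ V := by
  by_cases hsL : s ∈ L
  · right
    have hw : L.prod ∈ Subgroup.closure {x | x ∈ L} := List.prod_mem_closure fun x hx => hx
    have hs'L : s' ∈ L := by
      obtain ⟨i, rfl⟩ := hs'
      refine cs.simple_mem_of_mem_closure (I := {x | x ∈ L}) hL ?_
      have : cs.simple i = L.prod⁻¹ * (s * L.prod) := by rw [← hconj]; group
      rw [this]
      exact mul_mem (inv_mem hw) (mul_mem (Subgroup.subset_closure hsL) hw)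
    obtain ⟨U, V, rfl⟩ := List.append_of_mem hs'L
    refine ⟨U, V, rfl, ?_⟩
    by_contra hsV
    have hpre : s ∈ U ++ [s'] := by grind
    rw [cs.mul_prod_eq_of_mem_left hL hnd hconj hpre, hlen] at hdesc
    have := cs.length_prod_le (L := U ++ V) fun x hx => hL x (by grind)
    simp only [List.length_append, List.length_cons] at hdesc this
    omega
  · left
    have hss' : s = s' := by
      have hmem : s ∈ Subgroup.closure ({x | x ∈ L} ∪ {s'} : Set W) := by
        have hw : L.prod ∈ Subgroup.closure ({x | x ∈ L} ∪ {s'} : Set W) :=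
          List.prod_mem_closure fun x hx => Or.inl hx
        rw [← mul_inv_eq_iff_eq_mul.mpr hconj]
        exact mul_mem (mul_mem hw (Subgroup.subset_closure (Or.inr rfl))) (inv_mem hw)
      obtain ⟨i, rfl⟩ := hs
      rcases cs.simple_mem_of_mem_closure (by
        rintro x (hx | rfl)
        exacts [hL x hx, hs']) hmem with h | h
      · exact absurd h hsL
      · exact h
    subst hss'
    exact ⟨rfl, hsL, cs.commute_of_commute_prod hL hnd hs hsL hconj⟩

end CoxeterSystem

section

variable {B W : Type*} [Group W] {M : CoxeterMatrix B}

theorem csSupp_wordProd (cs : CoxeterSystem M W) {ω : List B} (hω : cs.IsReduced ω) :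
    csSupp cs (cs.wordProd ω) = {x | x ∈ ω.map cs.simple} := by
  ext x
  constructor
  · rintro ⟨l, hl, hprod, hx⟩
    obtain ⟨i, hi, rfl⟩ := List.mem_map.mp hx
    refine hl.simple_mem_of_wordProd_mem_closure (I := {x | x ∈ ω.map cs.simple}) ?_ ?_ i hi
    · rintro y hy
      obtain ⟨k, -, rfl⟩ := List.mem_map.mp hy
      exact ⟨k, rfl⟩
    · rw [hprod]
      exact cs.wordProd_mem_closure fun k hk => List.mem_map_of_mem hk
  · exact fun hx => ⟨ω, hω, rfl, hx⟩

theorem orbit_zpow_apply (δ : MulAut W) (m : ℤ) (x : W) :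
    {t | ∃ k : ℤ, (δ ^ k) ((δ ^ m) x) = t} = {t | ∃ k : ℤ, (δ ^ k) x = t} := by
  ext t
  constructor
  · rintro ⟨k, rfl⟩
    exact ⟨k + m, by rw [zpow_add]; rfl⟩
  · rintro ⟨k, rfl⟩
    exact ⟨k - m, by rw [← MulAut.mul_apply, ← zpow_add, sub_add_cancel]⟩

theorem nodup_map_orbit_of_length_eq_orbCount (δ : MulAut W) {A : Set W} {L : List W}
    (hA : A = ⋃ m : ℤ, (δ ^ m) '' {x | x ∈ L}) (hlen : L.length = orbCount δ A) :
    (L.map fun s => {t | ∃ m : ℤ, (δ ^ m) s = t}).Nodup := by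
  set orb : W → Set W := fun s => {t | ∃ m : ℤ, (δ ^ m) s = t}
  have hset : {O : Set W | ∃ s ∈ A, O = orb s} = ((L.map orb).toFinset : Set (Set W)) := by
    ext O
    simp only [Set.mem_ofPred_eq, List.coe_toFinset, List.mem_map]
    constructor
    · rintro ⟨s, hs, rfl⟩
      rw [hA] at hs
      obtain ⟨m, x, hx, rfl⟩ := Set.mem_iUnion.mp hs
      exact ⟨x, hx, (orbit_zpow_apply δ m x).symm⟩
    · rintro ⟨x, hx, rfl⟩
      refine ⟨x, ?_, rfl⟩
      rw [hA]
      exact Set.mem_iUnion.mpr ⟨0, x, hx, by simp⟩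
  rw [orbCount, hset, Set.ncard_coe_finset] at hlen
  rw [← Multiset.coe_nodup, ← Multiset.toFinset_card_eq_card_iff_nodup]
  simpa using hlen.symm

theorem exists_pow_succ_apply_eq_of_finite {δ : MulAut W} {A : Set W} (hA : A.Finite)
    {b : W} (hb : ∀ n : ℕ, (δ ^ n) b ∈ A) {s : W} {m : ℤ} (h : (δ ^ m) s = b) :
    ∃ k : ℕ, (δ ^ (k + 1)) s = b := by
  obtain ⟨p, -, q, -, hpq, heq⟩ := Set.infinite_univ.exists_lt_map_eq_of_mapsTo
    (f := fun n : ℕ => (δ ^ n) b) (fun n _ => hb n) hA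
  have hper : (δ ^ (q - p)) b = b := by
    apply (δ ^ p).injective
    rw [← MulAut.mul_apply, ← pow_add, Nat.add_sub_cancel' hpq.le]
    exact heq.symm
  have hperN : ∀ j : ℕ, ((δ ^ (q - p)) ^ j) b = b := by
    intro j
    induction j with
    | zero => simp
    | succ j ih => rw [pow_succ, MulAut.mul_apply, hper, ih]
  have hpos : (1 : ℤ) ≤ ((q - p : ℕ) : ℤ) := by omega
  have hge : 1 ≤ ((q - p : ℕ) : ℤ) * ((m.natAbs + 1 : ℕ) : ℤ) + m := by
    have : ((m.natAbs + 1 : ℕ) : ℤ) ≤ ((q - p : ℕ) : ℤ) * ((m.natAbs + 1 : ℕ) : ℤ) :=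
      le_mul_of_one_le_left (by positivity) hpos
    omega
  obtain ⟨k, hk⟩ := Int.le.dest hge
  refine ⟨k, ?_⟩
  rw [← hperN (m.natAbs + 1), ← h, ← MulAut.mul_apply, ← pow_mul, ← zpow_natCast,
    ← zpow_natCast, ← zpow_add]
  congr 2
  push_cast at hk ⊢
  linarith

theorem apply_mem_iff_of_image_eq {δ : MulAut W} {A : Set W} (hA : δ '' A = A) (x : W) :
    δ x ∈ A ↔ x ∈ A := by
  conv_lhs => rw [← hA]
  exact δ.injective.mem_set_image

theorem zpow_apply_mem_iff_of_image_eq {δ : MulAut W} {A : Set W} (hA : δ '' A = A) (m : ℤ)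
    (x : W) : (δ ^ m) x ∈ A ↔ x ∈ A := by
  induction m generalizing x with
  | zero => simp
  | succ n ih => rw [zpow_add_one, MulAut.mul_apply, ih, apply_mem_iff_of_image_eq hA]
  | pred n ih =>
    rw [zpow_sub_one, MulAut.mul_apply, ih, ← apply_mem_iff_of_image_eq hA]
    simp

theorem image_iUnion_zpow_image (δ : MulAut W) (A : Set W) :
    δ '' (⋃ m : ℤ, (δ ^ m) '' A) = ⋃ m : ℤ, (δ ^ m) '' A := by
  ext x
  constructor
  · rintro ⟨y, hy, rfl⟩
    obtain ⟨m, z, hz, rfl⟩ := Set.mem_iUnion.mp hy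
    exact Set.mem_iUnion.mpr ⟨1 + m, z, hz, by rw [zpow_add, zpow_one]; rfl⟩
  · intro hx
    obtain ⟨m, z, hz, rfl⟩ := Set.mem_iUnion.mp hx
    refine ⟨(δ ^ (m - 1)) z, Set.mem_iUnion.mpr ⟨m - 1, z, hz, rfl⟩, ?_⟩
    rw [← MulAut.mul_apply, ← zpow_one_add, add_sub_cancel]

theorem _root_.List.Nodup.eq_of_append_cons_eq {α : Type*} {L U V U' V' : List α} {b : α}
    (hnd : L.Nodup) (h : L = U ++ b :: V) (h' : L = U' ++ b :: V') : V = V' := by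
  subst h
  induction U generalizing U' with
  | nil => cases U' <;> grind
  | cons a U ih => cases U' <;> grind

/-- If every `s ∈ K` either satisfies `δ s ∈ K` with `δ s ∉ L`, or has `δ s` in `L` with some later
entry of `L` lying in `K`, then no `δ`-orbit of an element of `K` meets `L`. -/
theorem zpow_apply_notMem_of_stable {δ : MulAut W} {K : Set W} {L : List W} (hnd : L.Nodup)
    (horb : ∀ a ∈ L, ∀ b ∈ L, ∀ m : ℤ, (δ ^ m) a = b → a = b)
    (hper : ∀ b ∈ L, ∀ s : W, ∀ m : ℤ, (δ ^ m) s = b → ∃ k : ℕ, (δ ^ (k + 1)) s = b)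
    (hstep : ∀ s ∈ K, (δ s ∈ K ∧ δ s ∉ L) ∨ ∃ U V, L = U ++ δ s :: V ∧ ∃ x ∈ V, x ∈ K) :
    ∀ s ∈ K, ∀ m : ℤ, (δ ^ m) s ∉ L := by
  have hsuffix : ∀ V U : List W, L = U ++ V → ∀ s ∈ K, ∀ m : ℤ, (δ ^ m) s ∉ V := by
    intro V
    induction V with
    | nil => simp
    | cons b V ih =>
      intro U hL s hs m hmem
      have ih' := ih (U ++ [b]) (by simp [hL])
      have hbL : b ∈ L := by simp [hL]
      have hfirst : ∀ k : ℕ, ∀ s ∈ K, (δ ^ (k + 1)) s ≠ b := by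
        intro k
        induction k with
        | zero =>
          intro s hs hb
          rw [zero_add, pow_one] at hb
          rcases hstep s hs with ⟨-, h⟩ | ⟨U', V', hL', x, hxV, hxK⟩
          · exact h (hb ▸ hbL)
          · rw [hb] at hL'
            have hVV : V = V' := hnd.eq_of_append_cons_eq hL hL'
            exact ih' x hxK 0 (by simpa [hVV] using hxV)
        | succ k ihk =>
          intro s hs hb
          rw [pow_succ, MulAut.mul_apply] at hb
          rcases hstep s hs with ⟨h, -⟩ | ⟨U', V', hL', x, hxV, hxK⟩
          · exact ihk (δ s) h hb
          · have hδs : δ s = b := horb _ (by simp [hL']) b hbL ((k + 1 : ℕ) : ℤ)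
              (by rw [zpow_natCast]; exact hb)
            rw [hδs] at hL'
            have hVV : V = V' := hnd.eq_of_append_cons_eq hL hL'
            exact ih' x hxK 0 (by simpa [hVV] using hxV)
      rcases List.mem_cons.mp hmem with h | h
      · obtain ⟨k, hk⟩ := hper b hbL s m h
        exact hfirst k s hs hk
      · exact ih' s hs m h
  exact hsuffix L [] rfl

end

/-- if w is of minimal length in W_J·w and is a δ-Coxeter element of the
    finite standard parabolic subgroup W_{supp_δ(w)}, then the largest subset K ⊆ J with
    w·δ(K)·w⁻¹ = K is {s ∈ J : s commutes with every element of supp_δ(w)}; in particular,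
    every simple reflection in this largest subset commutes with every simple reflection
    in supp_δ(w). -/
theorem statement0 {B W : Type*} [Group W] {M : CoxeterMatrix B} (cs : CoxeterSystem M W)
    (δ : MulAut W) (hδS : δ '' Set.range cs.simple = Set.range cs.simple)
    (J : Set W) (hJS : J ⊆ Set.range cs.simple) (hδJ : δ '' J = J)
    (w : W)
    (hmin : ∀ x ∈ Subgroup.closure J, cs.length w ≤ cs.length (x * w))
    (hfin : Finite (Subgroup.closure (csSuppDelta cs δ w) : Subgroup W))
    (hcox : cs.length w = orbCount δ (csSuppDelta cs δ w)) :
    ((fun s => w * δ s * w⁻¹) '' {s ∈ J | ∀ t ∈ csSuppDelta cs δ w, s * t = t * s} =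
        {s ∈ J | ∀ t ∈ csSuppDelta cs δ w, s * t = t * s}) ∧
    (∀ K ⊆ J, (fun s => w * δ s * w⁻¹) '' K = K →
        K ⊆ {s ∈ J | ∀ t ∈ csSuppDelta cs δ w, s * t = t * s}) ∧
    (∀ s ∈ {s ∈ J | ∀ t ∈ csSuppDelta cs δ w, s * t = t * s},
        ∀ t ∈ csSuppDelta cs δ w, s * t = t * s) := by
  have hδJ' := apply_mem_iff_of_image_eq hδJ
  obtain ⟨ω, hω, rfl⟩ := cs.exists_isReduced w
  set L := ω.map cs.simple with hLdef
  have hprod : cs.wordProd ω = L.prod := rfl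
  have hLS : ∀ x ∈ L, x ∈ Set.range cs.simple := by
    intro x hx
    obtain ⟨i, -, rfl⟩ := List.mem_map.mp hx
    exact ⟨i, rfl⟩
  have hlen : cs.length L.prod = L.length := by rw [← hprod, hω.eq, hLdef, List.length_map]
  have hA : csSuppDelta cs δ (cs.wordProd ω) = ⋃ m : ℤ, (δ ^ m) '' {x | x ∈ L} := by
    rw [csSuppDelta, csSupp_wordProd cs hω]
  set A := csSuppDelta cs δ (cs.wordProd ω)
  have hδA : δ '' A = A := by rw [hA]; exact image_iUnion_zpow_image δ _
  have hLA : ∀ x ∈ L, x ∈ A := by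
    intro x hx
    rw [hA]
    exact Set.mem_iUnion.mpr ⟨0, x, hx, by simp⟩
  have hAfin : A.Finite := Set.Finite.subset (Set.toFinite (Subgroup.closure A : Set W))
    Subgroup.subset_closure
  rw [hprod] at hmin hcox
  rw [hlen] at hcox
  have hnd_orb := nodup_map_orbit_of_length_eq_orbCount δ hA hcox
  have hnd : L.Nodup := hnd_orb.of_map
  have horb : ∀ a ∈ L, ∀ b ∈ L, ∀ m : ℤ, (δ ^ m) a = b → a = b := by
    rintro a ha b hb m rfl
    exact List.inj_on_of_nodup_map hnd_orb ha hb (orbit_zpow_apply δ m a).symm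
  rw [hprod]
  refine ⟨?_, ?_, fun s hs => hs.2⟩
  · have hfix : ∀ s ∈ J, (∀ t ∈ A, s * t = t * s) → L.prod * δ s * L.prod⁻¹ = δ s := by
      intro s _ hs
      have hcomm : Commute (δ s) L.prod := by
        refine Commute.list_prod_right _ _ fun x hx => ?_
        obtain ⟨y, hy, rfl⟩ : x ∈ δ '' A := hδA.symm ▸ hLA x hx
        rw [Commute, SemiconjBy, ← map_mul, hs y hy, map_mul]
      rw [mul_inv_eq_iff_eq_mul, hcomm.eq]
    have hiff : ∀ s, (∀ t ∈ A, δ s * t = t * δ s) ↔ ∀ t ∈ A, s * t = t * s := by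
      intro s
      conv_lhs => rw [← hδA]
      simp only [Set.forall_mem_image, ← map_mul, δ.injective.eq_iff]
    ext x
    constructor
    · rintro ⟨s, ⟨hsJ, hs⟩, rfl⟩
      simp only [hfix s hsJ hs]
      exact ⟨(hδJ' s).mpr hsJ, (hiff s).mpr hs⟩
    · rintro ⟨hxJ, hx⟩
      obtain ⟨s, hsJ, rfl⟩ : x ∈ δ '' J := hδJ.symm ▸ hxJ
      have hs := (hiff s).mp hx
      exact ⟨s, ⟨hsJ, hs⟩, hfix s hsJ hs⟩
  · intro K hKJ hK
    have hσ : ∀ s ∈ K, L.prod * δ s * L.prod⁻¹ ∈ K := fun s hs =>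
      hK.subset ⟨s, hs, rfl⟩
    have hcase : ∀ s ∈ K, (L.prod * δ s * L.prod⁻¹ = δ s ∧ δ s ∉ L ∧ ∀ x ∈ L, δ s * x = x * δ s) ∨
        ∃ U V, L = U ++ δ s :: V ∧ L.prod * δ s * L.prod⁻¹ ∈ V := by
      intro s hs
      have hmem := hKJ (hσ s hs)
      rcases cs.eq_and_commute_or_precedes hLS hnd hlen (hJS hmem)
        (hJS ((hδJ' s).mpr (hKJ hs))) (by group)
        (hmin _ (Subgroup.subset_closure hmem)) with ⟨h, h', h''⟩ | h
      · rw [h] at h' h''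
        exact Or.inl ⟨h, h', h''⟩
      · exact Or.inr h
    have hnot := zpow_apply_notMem_of_stable (K := K) hnd horb
      (fun b hb s m h => exists_pow_succ_apply_eq_of_finite hAfin (fun n => by
        rw [← zpow_natCast, zpow_apply_mem_iff_of_image_eq hδA]
        exact hLA b hb) h)
      (fun s hs => by
        rcases hcase s hs with ⟨h, h', -⟩ | ⟨U, V, h, h'⟩
        · exact Or.inl ⟨h ▸ hσ s hs, h'⟩
        · exact Or.inr ⟨U, V, h, _, h', hσ s hs⟩)
    have hfix : ∀ s ∈ K, L.prod * δ s * L.prod⁻¹ = δ s ∧ ∀ x ∈ L, δ s * x = x * δ s := by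
      intro s hs
      rcases hcase s hs with ⟨h, -, h'⟩ | ⟨U, V, h, -⟩
      · exact ⟨h, h'⟩
      · exact absurd (by rw [zpow_one, h]; simp) (hnot s hs 1)
    have hδK : δ '' K = K := by
      conv_rhs => rw [← hK]
      exact Set.image_congr fun s hs => (hfix s hs).1.symm
    intro s hs
    refine ⟨hKJ hs, fun t ht => ?_⟩
    rw [hA] at ht
    obtain ⟨m, x, hx, rfl⟩ := Set.mem_iUnion.mp ht
    obtain ⟨r, rfl⟩ := (δ ^ m).surjective s
    rw [zpow_apply_mem_iff_of_image_eq hδK, ← hδK] at hs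
    obtain ⟨q, hq, rfl⟩ := hs
    rw [← map_mul, (hfix q hq).2 x hx, map_mul]
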